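/- Let α ≥ 0, let n ≥ 1 and k ≥ 1 be integers. Then there exist R > 0 and functions φ_1, …, φ_k : ℝ² → ℝ, linearly independent, each continuous on ℝ² with support contained in the closed ball of radius R centered at the origin, continuously differentiable on the open ball of radius R, and n-invariant, such that ∫_{ℝ²} |∇φ_j|² dx − ∫_{ℝ²} |x|^α φ_j² dx < 0 for every j = 1, …, k. -/

import Mathlib

open Real MeasureTheory Metric Filter Topology

noncomputable section

/-- The Euclidean plane. -/
abbrev E2 := EuclideanSpace ℝ (Fin 2)

/-- Rotation of the plane by the angle `φ` about the origin. -/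
def rot2 (φ : ℝ) (q : E2) : E2 :=
  (EuclideanSpace.equiv (Fin 2) ℝ).symm
    ![Real.cos φ * q 0 - Real.sin φ * q 1, Real.sin φ * q 0 + Real.cos φ * q 1]

/-- Reflection of the plane across the horizontal axis. -/
def reflX (q : E2) : E2 :=
  (EuclideanSpace.equiv (Fin 2) ℝ).symm ![q 0, -q 1]

/-- `u` is `n`-invariant: in polar coordinates it is even in `θ` and `2π/n`-periodic in `θ`,
i.e. it is invariant under the reflection across the horizontal axis and under the rotation
by `2π/n`. -/
def nInvariant (n : ℕ) (u : E2 → ℝ) : Prop :=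
  (∀ q : E2, u (reflX q) = u q) ∧ (∀ q : E2, u (rot2 (2 * π / n) q) = u q)

lemma norm_rot2 (φ : ℝ) (q : E2) : ‖rot2 φ q‖ = ‖q‖ := by
  simp only [EuclideanSpace.norm_eq, Fin.sum_univ_two, Real.norm_eq_abs, sq_abs]
  congr 1
  simp only [rot2, EuclideanSpace.equiv, PiLp.continuousLinearEquiv_symm_apply,
    Matrix.cons_val_zero, Matrix.cons_val_one]
  linear_combination (q 0 ^ 2 + q 1 ^ 2) * Real.sin_sq_add_cos_sq φ

lemma norm_reflX (q : E2) : ‖reflX q‖ = ‖q‖ := by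
  simp [EuclideanSpace.norm_eq, reflX, EuclideanSpace.equiv]

/-- A function of the norm is `n`-invariant. -/
lemma nInvariant_comp_norm (n : ℕ) (f : ℝ → ℝ) : nInvariant n (fun x => f ‖x‖) :=
  ⟨fun q => by simp only [norm_reflX], fun q => by simp only [norm_rot2]⟩

/-- A smooth radial function, positive exactly on the open ball of radius `ρ`. -/
def radialBump (ρ : ℝ) (x : E2) : ℝ := Real.smoothTransition (1 - ‖ρ⁻¹ • x‖ ^ 2)

lemma contDiff_radialBump (ρ : ℝ) : ContDiff ℝ 1 (radialBump ρ) :=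
  Real.smoothTransition.contDiff.comp
    (contDiff_const.sub ((contDiff_id.const_smul ρ⁻¹).norm_sq ℝ))

lemma radialBump_eq (ρ : ℝ) : radialBump ρ = fun x => radialBump 1 (ρ⁻¹ • x) := by
  funext x; simp [radialBump]

lemma radialBump_nonneg (ρ : ℝ) (x : E2) : 0 ≤ radialBump ρ x :=
  Real.smoothTransition.nonneg _

lemma radialBump_eq_zero {ρ : ℝ} (hρ : 0 < ρ) {x : E2} (hx : ρ ≤ ‖x‖) : radialBump ρ x = 0 := by
  apply Real.smoothTransition.zero_of_nonpos
  rw [norm_smul, norm_inv, Real.norm_of_nonneg hρ.le, inv_mul_eq_div]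
  have : 1 ≤ ‖x‖ / ρ := (one_le_div hρ).2 hx
  nlinarith

lemma radialBump_pos {ρ : ℝ} (hρ : 0 < ρ) {x : E2} (hx : ‖x‖ < ρ) : 0 < radialBump ρ x := by
  apply Real.smoothTransition.pos_of_pos
  rw [norm_smul, norm_inv, Real.norm_of_nonneg hρ.le, inv_mul_eq_div]
  have h1 : ‖x‖ / ρ < 1 := (div_lt_one hρ).2 hx
  have h0 : 0 ≤ ‖x‖ / ρ := by positivity
  nlinarith

lemma support_radialBump_subset {ρ : ℝ} (hρ : 0 < ρ) :
    Function.support (radialBump ρ) ⊆ closedBall 0 ρ := by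
  intro x hx
  rw [mem_closedBall_zero_iff]
  by_contra! h
  exact hx (radialBump_eq_zero hρ h.le)

lemma nInvariant_radialBump (n : ℕ) (ρ : ℝ) : nInvariant n (radialBump ρ) := by
  have : radialBump ρ = fun x => Real.smoothTransition (1 - (‖ρ⁻¹‖ * ‖x‖) ^ 2) := by
    funext x; rw [radialBump, norm_smul]
  rw [this]
  exact nInvariant_comp_norm n fun r => Real.smoothTransition (1 - (‖ρ⁻¹‖ * r) ^ 2)

/-- The Dirichlet integral is scale invariant in the plane. -/
lemma integral_norm_fderiv_radialBump {ρ : ℝ} (hρ : 0 < ρ) :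
    ∫ x : E2, ‖fderiv ℝ (radialBump ρ) x‖ ^ 2 = ∫ x : E2, ‖fderiv ℝ (radialBump 1) x‖ ^ 2 := by
  have h : ∀ x : E2, ‖fderiv ℝ (radialBump ρ) x‖ ^ 2
      = ρ⁻¹ ^ 2 * ‖fderiv ℝ (radialBump 1) (ρ⁻¹ • x)‖ ^ 2 := by
    intro x
    rw [radialBump_eq ρ, fderiv_comp_smul, norm_smul, mul_pow, Real.norm_eq_abs, sq_abs]
  simp_rw [h]
  rw [integral_const_mul,
    Measure.integral_comp_smul volume (fun x : E2 => ‖fderiv ℝ (radialBump 1) x‖ ^ 2)]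
  simp only [finrank_euclideanSpace, Fintype.card_fin, smul_eq_mul]
  rw [abs_of_nonneg (by positivity)]
  field_simp

lemma integral_weight_radialBump (α : ℝ) {ρ : ℝ} (hρ : 0 < ρ) :
    ∫ x : E2, ‖x‖ ^ α * radialBump ρ x ^ 2
      = ρ ^ α * ρ ^ 2 * ∫ x : E2, ‖x‖ ^ α * radialBump 1 x ^ 2 := by
  have h : ∀ x : E2, ‖x‖ ^ α * radialBump ρ x ^ 2
      = ρ ^ α * (‖ρ⁻¹ • x‖ ^ α * radialBump 1 (ρ⁻¹ • x) ^ 2) := by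
    intro x
    rw [← mul_assoc, ← Real.mul_rpow hρ.le (norm_nonneg _), norm_smul, norm_inv,
      Real.norm_of_nonneg hρ.le, mul_inv_cancel_left₀ hρ.ne', radialBump_eq ρ]
  simp_rw [h]
  rw [integral_const_mul,
    Measure.integral_comp_smul volume (fun x : E2 => ‖x‖ ^ α * radialBump 1 x ^ 2)]
  simp only [finrank_euclideanSpace, Fintype.card_fin, smul_eq_mul]
  rw [abs_of_nonneg (by positivity), inv_pow, inv_inv, mul_assoc]

lemma integral_weight_radialBump_one_pos {α : ℝ} (hα : 0 ≤ α) :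
    0 < ∫ x : E2, ‖x‖ ^ α * radialBump 1 x ^ 2 := by
  obtain ⟨x, hx⟩ := NormedSpace.exists_lt_norm ℝ E2 0
  set y : E2 := (2 * ‖x‖)⁻¹ • x
  have hy : ‖y‖ = 1 / 2 := by
    rw [norm_smul, norm_inv, Real.norm_of_nonneg (by positivity)]
    field_simp
  refine Continuous.integral_pos_of_hasCompactSupport_nonneg_nonzero (x := y) ?_ ?_ ?_ ?_
  · exact (continuous_norm.rpow_const fun _ => .inr hα).mul
      ((contDiff_radialBump 1).continuous.pow 2)
  · refine HasCompactSupport.intro (isCompact_closedBall 0 1) fun z hz => ?_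
    rw [mem_closedBall_zero_iff, not_le] at hz
    simp [radialBump_eq_zero one_pos hz.le]
  · intro z
    have := radialBump_nonneg 1 z
    positivity
  · have := radialBump_pos one_pos (x := y) (by rw [hy]; norm_num)
    rw [hy]
    positivity

/-- Functions that can be separated triangularly by point evaluations are linearly independent. -/
lemma linearIndependent_of_triangular_eval {X : Type*} {k : ℕ} (f : Fin k → X → ℝ)
    (p : Fin k → X) (hdiag : ∀ i, f i (p i) ≠ 0) (hlt : ∀ i j, j < i → f j (p i) = 0) :
    LinearIndependent ℝ f := by
  let A : Matrix (Fin k) (Fin k) ℝ := fun j i => f j (p i)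
  have hA : A.BlockTriangular OrderDual.toDual := fun j i hji => hlt i j hji
  have hdet : A.det ≠ 0 := by
    rw [Matrix.det_of_isLowerTriangular A hA]
    exact Finset.prod_ne_zero_iff.2 fun i _ => hdiag i
  exact (Matrix.linearIndependent_rows_of_det_ne_zero hdet).of_comp (LinearMap.funLeft ℝ ℝ p)

/-- for every `k` there are `k` linearly independent `n`-invariant functions,
continuous with support in `closedBall 0 R` and `C¹` in `ball 0 R`, on which the quadratic
form `∫(|∇φ|² − |x|^α φ²)` over `ℝ²` is negative. -/
theorem stmt_12 (α : ℝ) (hα : 0 ≤ α) (n k : ℕ) (hn : 1 ≤ n) (hk : 1 ≤ k) :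
    ∃ R : ℝ, 0 < R ∧ ∃ φs : Fin k → (E2 → ℝ), LinearIndependent ℝ φs ∧
      ∀ j : Fin k,
        Continuous (φs j) ∧
        Function.support (φs j) ⊆ closedBall 0 R ∧
        ContDiffOn ℝ 1 (φs j) (ball 0 R) ∧
        nInvariant n (φs j) ∧
        (∫ x : E2, ‖fderiv ℝ (φs j) x‖ ^ 2) - (∫ x : E2, ‖x‖ ^ α * (φs j x) ^ 2) < 0 := by
  set D := ∫ x : E2, ‖fderiv ℝ (radialBump 1) x‖ ^ 2 with hD
  set W := ∫ x : E2, ‖x‖ ^ α * radialBump 1 x ^ 2 with hW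
  have hW0 : 0 < W := integral_weight_radialBump_one_pos hα
  set a : ℝ := max 1 (D / W)
  have ha1 : 1 ≤ a := le_max_left _ _
  have haD : D ≤ a * W := (div_le_iff₀ hW0).1 (le_max_right _ _)
  have hpos : ∀ j : Fin k, 0 < a + j + 1 := fun j => by positivity
  refine ⟨a + k, by positivity, fun j => radialBump (a + j + 1), ?_, fun j => ⟨?_, ?_, ?_, ?_, ?_⟩⟩
  · obtain ⟨x, hx⟩ := NormedSpace.exists_lt_norm ℝ E2 0
    have hnorm : ∀ i : Fin k, ‖((a + i) / ‖x‖) • x‖ = a + i := fun i => by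
      rw [norm_smul, Real.norm_of_nonneg (by positivity)]
      field_simp
    refine linearIndependent_of_triangular_eval _ (fun i => ((a + i) / ‖x‖) • x) (fun i => ?_)
      fun i j hji => ?_
    · exact (radialBump_pos (hpos i) (by rw [hnorm]; linarith)).ne'
    · refine radialBump_eq_zero (hpos j) ?_
      rw [hnorm]
      have : (j : ℝ) + 1 ≤ i := by exact_mod_cast hji
      linarith
  · exact (contDiff_radialBump _).continuous
  · refine (support_radialBump_subset (hpos j)).trans (closedBall_subset_closedBall ?_)
    have : (j : ℝ) + 1 ≤ k := by exact_mod_cast j.isLt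
    linarith
  · exact (contDiff_radialBump _).contDiffOn
  · exact nInvariant_radialBump n _
  · rw [integral_norm_fderiv_radialBump (hpos j), integral_weight_radialBump α (hpos j), ← hD, ← hW]
    have hj : (0 : ℝ) ≤ j := by positivity
    have h1 : 1 ≤ (a + j + 1) ^ α := Real.one_le_rpow (by linarith) hα
    have h2 : a < (a + j + 1) ^ 2 := by nlinarith
    have h3 : (a + j + 1) ^ 2 ≤ (a + j + 1) ^ α * (a + j + 1) ^ 2 :=
      le_mul_of_one_le_left (by positivity) h1
    have h4 : a * W < (a + j + 1) ^ α * (a + j + 1) ^ 2 * W :=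
      mul_lt_mul_of_pos_right (h2.trans_le h3) hW0
    linarith
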